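/- Let q = p^e with p > 3 prime and q ≡ 1 (mod 12), E an elliptic curve over F_q with j(E) ≠ 0, 1728, and T a generator of the character group of F_q^*. Then the trace of Frobenius satisfies a(E/F_q) = −q · T^{(q-1)/12}(1728/Δ(E)) · ₂F₁(T^{(q-1)/12}, T^{(q-1)/12}; T^{2(q-1)/3} | j(E)/1728)_q, where Δ(E) is the discriminant and j(E) the j-invariant of E. -/

import Mathlib

open Finset

/-- The canonical additive character `θ(α) = e^{2πi·tr(α)/p}` of `F = F_q`, `q = p^e`. -/
noncomputable def theta (p : ℕ) (F : Type) [Field F] [Fintype F] [Algebra (ZMod p) F]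
    (α : F) : ℂ :=
  Complex.exp (2 * Real.pi * Complex.I * ((Algebra.trace (ZMod p) F α).val : ℂ) / p)

/-- The Gauss sum `G_m = ∑_{x ∈ F_q} T^m(x) θ(x)` (recall `T^m (0) = 0` for `T^m` nontrivial,
and characters are extended by `χ(0) = 0`). -/
noncomputable def gaussT (p : ℕ) (F : Type) [Field F] [Fintype F] [Algebra (ZMod p) F]
    (T : MulChar F ℂ) (m : ℤ) : ℂ :=
  ∑ x : F, (T ^ m) x * theta p F x

/-- The normalized Jacobi sum `binom(A,B) = (B(-1)/q) · J(A, B̄)`. -/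
noncomputable def binomC (F : Type) [Field F] [Fintype F] (A B : MulChar F ℂ) : ℂ :=
  B (-1) / (Fintype.card F : ℂ) * jacobiSum A B⁻¹

/-- Greene's Gaussian hypergeometric series `₂F₁(A,B;C|x)_q`, the sum over all
multiplicative characters `χ = T^m` of `F_q^*`, written via a generator `T` of the
character group. -/
noncomputable def hypF21 (F : Type) [Field F] [Fintype F] (T : MulChar F ℂ)
    (A B C : MulChar F ℂ) (x : F) : ℂ :=
  (Fintype.card F : ℂ) / ((Fintype.card F : ℂ) - 1) *
    ∑ m ∈ Finset.range (Fintype.card F - 1),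
      binomC F (A * T ^ m) (T ^ m) * binomC F (B * T ^ m) (C * T ^ m) * (T ^ m) x

section Cubic

variable {F : Type} [Field F]

theorem card_cubic_roots_le_three [Fintype F] [DecidableEq F] (P c : F) :
    #{y : F | y ^ 3 = 27 * P * (y - c)} ≤ 3 := by
  classical
  let f : Polynomial F := Cubic.toPoly ⟨1, 0, -27 * P, 27 * P * c⟩
  have hf : f ≠ 0 := Cubic.ne_zero_of_a_ne_zero one_ne_zero
  have hdeg : f.natDegree = 3 := Cubic.natDegree_of_a_ne_zero one_ne_zero
  calc #{y : F | y ^ 3 = 27 * P * (y - c)} ≤ #f.roots.toFinset := by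
        apply card_le_card
        intro y hy
        rw [mem_filter] at hy
        rw [Multiset.mem_toFinset, Polynomial.mem_roots hf, Polynomial.IsRoot.def]
        simp only [f, Cubic.toPoly, Polynomial.eval_add, Polynomial.eval_mul, Polynomial.eval_C,
          Polynomial.eval_pow, Polynomial.eval_X]
        linear_combination hy.2
    _ ≤ f.roots.card := Multiset.toFinset_card_le _
    _ ≤ 3 := hdeg ▸ f.card_roots'

theorem card_cubic_roots_le_two [Fintype F] [DecidableEq F] (h2 : (2 : F) ≠ 0) {P c : F}
    (hP : c ^ 2 = 4 * P) :
    #{y : F | y ^ 3 = 27 * P * (y - c)} ≤ 2 := by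
  refine (card_le_card (t := {3 * c / 2, -3 * c}) ?_).trans card_le_two
  intro y hy
  rw [mem_filter] at hy
  have h : (2 * y - 3 * c) ^ 2 * (y + 3 * c) = 0 := by
    linear_combination 4 * hy.2 + 27 * (c - y) * hP
  rw [mem_insert, mem_singleton]
  rcases mul_eq_zero.1 h with h | h
  · left
    rw [eq_div_iff h2]
    linear_combination pow_eq_zero_iff two_ne_zero |>.1 h
  · right
    linear_combination h

theorem exists_add_eq_of_cubic_roots (h2 : (2 : F) ≠ 0) (h3 : (3 : F) ≠ 0) {d : F}
    (hd : d ^ 2 = -3) {P c y z : F} (hP : P ≠ 0) (hy : y ^ 3 = 27 * P * (y - c))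
    (hz : z ^ 3 = 27 * P * (z - c)) (hyz : y ≠ z) : ∃ u, u ≠ 0 ∧ u + P / u = c := by
  have hd0 : d ≠ 0 := by
    rintro rfl
    apply h3
    linear_combination hd
  have hq : y ^ 2 + y * z + z ^ 2 = 27 * P := by
    apply mul_left_cancel₀ (sub_ne_zero.2 hyz)
    linear_combination hy - hz
  have hc : 27 * P * c = y * z * (y + z) := by
    linear_combination hy - y * hq
  set e : F := (y - z) * (2 * y + z) * (y + 2 * z) / (81 * P * d) with he
  have h81 : (81 : F) ≠ 0 := by
    have : (81 : F) = 3 ^ 4 := by norm_num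
    rw [this]; exact pow_ne_zero _ h3
  have h27 : (27 : F) ≠ 0 := by
    have : (27 : F) = 3 ^ 3 := by norm_num
    rw [this]; exact pow_ne_zero _ h3
  have he2 : e ^ 2 = c ^ 2 - 4 * P := by
    have hD : ((y - z) * (2 * y + z) * (y + 2 * z)) ^ 2 =
        4 * (27 * P) ^ 3 - 27 * (27 * P * c) ^ 2 := by
      rw [hc, ← hq]; ring
    have hden : (81 * P * d) ^ 2 = -19683 * P ^ 2 := by
      linear_combination 6561 * P ^ 2 * hd
    rw [he, div_pow, hD, div_eq_iff (pow_ne_zero _ (by simp [h81, hP, hd0])), hden]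
    ring
  have hprod : (c + e) / 2 * ((c - e) / 2) = P := by
    field_simp
    linear_combination -he2
  refine ⟨(c + e) / 2, left_ne_zero_of_mul (hprod ▸ hP), ?_⟩
  have h0 : (c + e) / 2 ≠ 0 := left_ne_zero_of_mul (hprod ▸ hP)
  rw [(div_eq_iff h0).2 (by rw [mul_comm, hprod] : P = (c - e) / 2 * ((c + e) / 2))]
  field_simp
  ring

theorem exists_cube_ratio (h2 : (2 : F) ≠ 0) (h3 : (3 : F) ≠ 0) {X Z y : F} (hX : X ≠ 0)
    (hZ : Z ≠ 0) (hXZ : X ≠ Z) (hy : y ^ 3 = 27 * (X * Z) * (y - (X + Z))) :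
    ∃ r, X / Z = r ^ 3 := by
  set m : F := y ^ 2 - 9 * (X * Z) with hm
  set k : F := -27 * (X * Z) * (X - Z) with hk
  have h27 : (27 : F) ≠ 0 := by
    have : (27 : F) = 3 ^ 3 := by norm_num
    rw [this]; exact pow_ne_zero _ h3
  have hk0 : k ≠ 0 := by
    simp [hk, h27, hX, hZ, sub_ne_zero.2 hXZ]
  have hm0 : m ≠ 0 := by
    intro h
    have h9 : 9 * (X * Z) * (2 * y - 3 * (X + Z)) = 0 := by
      linear_combination y * h - hy
    have h9' : (9 : F) ≠ 0 := by
      have : (9 : F) = 3 ^ 2 := by norm_num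
      rw [this]; exact pow_ne_zero _ h3
    have hlin : 2 * y - 3 * (X + Z) = 0 := by
      simpa [h9', hX, hZ] using h9
    have : 9 * (X - Z) ^ 2 = 0 := by
      linear_combination 4 * h - (2 * y + 3 * (X + Z)) * hlin
    simp [h9', sub_ne_zero.2 hXZ] at this
  have key : X * (y * m - k) ^ 3 = Z * (y * m + k) ^ 3 := by
    set Q : F := 27 * (X * Z) * (X + Z) with hQ
    set R : F := 27 * (X * Z) * y - y ^ 3 with hR
    have hRQ : Q = R := by linear_combination hy
    linear_combination (X - Z) * (Q ^ 2 + (3 * y * m + R) * Q + (3 * y ^ 2 * m ^ 2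
      - 2916 * (X * Z) ^ 3 + 3 * y * m * R + R ^ 2)) * hRQ
  have hv : y * m - k ≠ 0 := by
    intro h
    rw [h] at key
    have h' : y * m + k = 0 := by
      simpa [hZ] using key.symm
    have : 2 * k = 0 := by linear_combination h' - h
    simp [h2, hk0] at this
  refine ⟨(y * m + k) / (y * m - k), ?_⟩
  rw [div_pow, div_eq_div_iff hZ (pow_ne_zero _ hv)]
  linear_combination key

end Cubic

section CubicSum

variable {F : Type} [Field F]

theorem MulChar.apply_pow_order {ω : MulChar F ℂ} (hω : ω ^ 3 = 1) {x : F} (hx : x ≠ 0) :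
    ω x ^ 3 = 1 := by
  rw [← MulChar.pow_apply' ω three_ne_zero, hω, MulChar.one_apply hx.isUnit]

variable [Fintype F] [DecidableEq F]

theorem card_cubic_roots_le_sum (h2 : (2 : F) ≠ 0) (h3 : (3 : F) ≠ 0) {d : F}
    (hd : d ^ 2 = -3) {ω : MulChar F ℂ} (hω : ω ^ 3 = 1) {P : F} (hP : P ≠ 0) (c : F) :
    ∃ m : ℕ, (1 + ∑ u : F with u ≠ 0 ∧ u + P / u = c, ω (u ^ 2 / P)) = m ∧
      #{y : F | y ^ 3 = 27 * P * (y - c)} ≤ m := by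
  by_cases hU : ∃ u, u ≠ 0 ∧ u + P / u = c
  · obtain ⟨u, hu, huc⟩ := hU
    obtain ⟨v, hv⟩ : ∃ v, v = P / u := ⟨_, rfl⟩
    have huv : u * v = P := by rw [hv]; field_simp
    have hv0 : v ≠ 0 := right_ne_zero_of_mul (huv ▸ hP)
    rw [← hv] at huc
    have hset : ({u : F | u ≠ 0 ∧ u + P / u = c} : Finset F) = {u, v} := by
      ext w
      simp only [mem_filter, mem_univ, true_and, mem_insert, mem_singleton]
      constructor
      · rintro ⟨hw, hwc⟩
        have : (w - u) * (w - v) = 0 := by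
          field_simp at hwc
          linear_combination hwc + huv - w * huc
        rcases mul_eq_zero.1 this with h | h
        · exact Or.inl (sub_eq_zero.1 h)
        · exact Or.inr (sub_eq_zero.1 h)
      · rintro (rfl | rfl)
        · exact ⟨hu, by rw [← hv, huc]⟩
        · refine ⟨hv0, ?_⟩
          rw [← huv, mul_div_cancel_right₀ _ hv0, add_comm, huc]
    rw [hset]
    by_cases huv' : u = v
    · refine ⟨2, ?_, card_cubic_roots_le_two h2 ?_⟩
      · subst huv'
        rw [pair_eq_singleton, sum_singleton, ← huv, ← pow_two, div_self (pow_ne_zero _ hu),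
          map_one]
        norm_num
      · subst huv'
        linear_combination -(c + 2 * u) * huc + 4 * huv
    · rw [sum_pair huv']
      have e1 : u ^ 2 / P = u / v := by rw [← huv]; field_simp
      have e2 : v ^ 2 / P = (u / v)⁻¹ := by rw [← huv]; field_simp
      rw [e1, e2]
      have hr : ω (u / v) * ω (u / v)⁻¹ = 1 := by
        rw [← map_mul, mul_inv_cancel₀ (div_ne_zero hu hv0), map_one]
      have hr3 := MulChar.apply_pow_order hω (div_ne_zero hu hv0)
      by_cases h1 : ω (u / v) = 1
      · refine ⟨3, ?_, card_cubic_roots_le_three P c⟩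
        rw [h1, one_mul] at hr
        rw [h1, hr]
        norm_num
      · refine ⟨0, ?_, ?_⟩
        · have hne : ω (u / v) - 1 ≠ 0 := sub_ne_zero.2 h1
          have hsum : 1 + ω (u / v) + ω (u / v) ^ 2 = 0 := by
            apply mul_left_cancel₀ hne
            linear_combination hr3
          push_cast
          linear_combination hsum + ω (u / v) ^ 2 * hr - ω (u / v)⁻¹ * hr3
        · rw [Nat.le_zero, card_eq_zero, filter_eq_empty_iff]
          intro y _ hy
          rw [← huv, ← huc] at hy
          obtain ⟨r, hr⟩ := exists_cube_ratio h2 h3 hu hv0 huv' hy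
          apply h1
          have hr0 : r ≠ 0 := by
            rintro rfl
            simp [hu, hv0] at hr
          rw [hr, map_pow, MulChar.apply_pow_order hω hr0]
  · refine ⟨1, ?_, ?_⟩
    · rw [filter_eq_empty_iff.2 fun u _ hu => hU ⟨u, hu⟩]
      simp
    · rw [card_le_one]
      intro y hy z hz
      rw [mem_filter] at hy hz
      by_contra hyz
      exact hU (exists_add_eq_of_cubic_roots h2 h3 hd hP hy.2 hz.2 hyz)

/-- Cardano's formulas over a finite field, in terms of a cubic character. -/
theorem card_cubic_roots (h2 : (2 : F) ≠ 0) (h3 : (3 : F) ≠ 0) {d : F}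
    (hd : d ^ 2 = -3) {ω : MulChar F ℂ} (hω : ω ^ 3 = 1) (hω1 : ω ≠ 1) {P : F} (hP : P ≠ 0)
    (c : F) :
    (#{y : F | y ^ 3 = 27 * P * (y - c)} : ℂ) =
      1 + ∑ u : F with u ≠ 0 ∧ u + P / u = c, ω (u ^ 2 / P) := by
  choose m hm hle using card_cubic_roots_le_sum h2 h3 hd hω hP
  have h27P : 27 * P ≠ 0 := by
    have : (27 : F) = 3 ^ 3 := by norm_num
    rw [this]; exact mul_ne_zero (pow_ne_zero _ h3) hP
  have hω2 : ω ^ 2 ≠ 1 := by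
    intro h
    apply hω1
    rwa [pow_succ, h, one_mul] at hω
  have hcard : ∑ c : F, #{y : F | y ^ 3 = 27 * P * (y - c)} = Fintype.card F := by
    have (c : F) : ({y : F | y ^ 3 = 27 * P * (y - c)} : Finset F) =
        ({y : F | y - y ^ 3 / (27 * P) = c} : Finset F) := by
      ext y
      simp only [mem_filter, mem_univ, true_and]
      rw [sub_eq_iff_eq_add, ← sub_eq_iff_eq_add', eq_div_iff h27P, eq_comm, mul_comm]
    simp_rw [this]
    exact (card_eq_sum_card_fiberwise fun _ _ => mem_coe.2 (mem_univ _)).symm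
  have hsum : ∑ c : F, m c = Fintype.card F := by
    have h : ∑ c : F, (m c : ℂ) = Fintype.card F := by
      simp_rw [← hm, sum_add_distrib, sum_const, card_univ, nsmul_eq_mul, mul_one]
      rw [add_eq_left]
      have h1 (c : F) : ∑ u : F with u ≠ 0 ∧ u + P / u = c, ω (u ^ 2 / P) =
          ∑ u : F with u + P / u = c, ω (u ^ 2 / P) := by
        refine sum_subset (fun u => by simp +contextual) fun u hu hu' => ?_
        simp only [mem_filter, mem_univ, true_and] at hu hu'
        have : u = 0 := by tauto
        simp [this, MulChar.map_zero]
      rw [sum_congr rfl fun c _ => h1 c, sum_fiberwise]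
      simp_rw [div_eq_mul_inv, map_mul, ← sum_mul, map_pow,
        ← MulChar.pow_apply' ω two_ne_zero]
      rw [MulChar.sum_eq_zero_of_ne_one hω2, zero_mul]
    exact_mod_cast h
  have := (sum_eq_sum_iff_of_le fun c _ => hle c).1 (hcard.trans hsum.symm) c (mem_univ c)
  rw [this, hm]

theorem sum_addChar_cubic (h2 : (2 : F) ≠ 0) (h3 : (3 : F) ≠ 0) {d : F}
    (hd : d ^ 2 = -3) {ω : MulChar F ℂ} (hω : ω ^ 3 = 1) (hω1 : ω ≠ 1) {P : F} (hP : P ≠ 0)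
    {θ : AddChar F ℂ} (hθ : θ ≠ 1) :
    ∑ y : F, θ (y - y ^ 3 / (27 * P)) = ∑ u : F, ω (u ^ 2 / P) * θ (u + P / u) := by
  have h27P : 27 * P ≠ 0 := by
    have : (27 : F) = 3 ^ 3 := by norm_num
    rw [this]; exact mul_ne_zero (pow_ne_zero _ h3) hP
  have hL : ∑ y : F, θ (y - y ^ 3 / (27 * P)) =
      ∑ c : F, (#{y : F | y ^ 3 = 27 * P * (y - c)} : ℂ) * θ c := by
    rw [← sum_fiberwise univ fun y : F => y - y ^ 3 / (27 * P)]
    refine sum_congr rfl fun c _ => ?_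
    rw [← nsmul_eq_mul, ← sum_const]
    refine sum_congr ?_ fun y hy => ?_
    · ext y
      simp only [mem_filter, mem_univ, true_and]
      rw [sub_eq_iff_eq_add, ← sub_eq_iff_eq_add', eq_div_iff h27P, eq_comm, mul_comm]
    · simp only [mem_filter, mem_univ, true_and] at hy
      congr 1
      rw [sub_eq_iff_eq_add, ← sub_eq_iff_eq_add', eq_div_iff h27P, hy, mul_comm]
  have hR : ∑ u : F, ω (u ^ 2 / P) * θ (u + P / u) =
      ∑ c : F, (∑ u : F with u ≠ 0 ∧ u + P / u = c, ω (u ^ 2 / P)) * θ c := by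
    rw [← sum_fiberwise univ fun u : F => u + P / u]
    refine sum_congr rfl fun c _ => ?_
    rw [sum_mul]
    symm
    refine sum_subset_zero_on_sdiff (fun u => by simp +contextual) (fun u hu => ?_) fun u hu => ?_
    · simp only [mem_sdiff, mem_filter, mem_univ, true_and] at hu
      have : u = 0 := by tauto
      simp [this, MulChar.map_zero]
    · rw [(mem_filter.1 hu).2.2]
  rw [hL, hR]
  simp_rw [card_cubic_roots h2 h3 hd hω hω1 hP, add_mul, one_mul, sum_add_distrib,
    AddChar.sum_eq_zero_of_ne_one hθ, zero_add]

end CubicSum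

section GaussSum

variable {F : Type} [Field F]

theorem MulChar.inv_mul_apply_self (χ : MulChar F ℂ) {x : F} (hx : x ≠ 0) :
    χ⁻¹ x * χ x = 1 := by
  rw [← MulChar.mul_apply, MulChar.inv_mul, MulChar.one_apply hx.isUnit]

theorem MulChar.pow_apply_eq_one {χ : MulChar F ℂ} {n : ℕ} (h : χ ^ n = 1) (hn : n ≠ 0) {x : F}
    (hx : x ≠ 0) : χ (x ^ n) = 1 := by
  rw [map_pow, ← MulChar.pow_apply' χ hn, h, MulChar.one_apply hx.isUnit]

variable [Fintype F]

theorem sum_mulChar_mul_addChar (χ : MulChar F ℂ) (θ : AddChar F ℂ) {c : F} (hc : c ≠ 0) :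
    ∑ x, χ x * θ (c * x) = χ⁻¹ c * gaussSum χ θ :=
  gaussSum_mulShift_eq χ θ (Units.mk0 c hc)

theorem sum_mulChar_mul_addChar_of_ne_one {χ : MulChar F ℂ} (hχ : χ ≠ 1) (θ : AddChar F ℂ)
    (c : F) : ∑ x, χ x * θ (c * x) = χ⁻¹ c * gaussSum χ θ := by
  rcases eq_or_ne c 0 with rfl | hc
  · simp [MulChar.sum_eq_zero_of_ne_one hχ, MulChar.map_zero]
  · exact sum_mulChar_mul_addChar χ θ hc

theorem gaussSum_mul_gaussSum_inv {χ : MulChar F ℂ} (hχ : χ ≠ 1) {θ : AddChar F ℂ}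
    (hθ : θ ≠ 1) : gaussSum χ θ * gaussSum χ⁻¹ θ = χ (-1) * Fintype.card F := by
  rw [← gaussSum_mul_gaussSum_eq_card hχ (AddChar.IsPrimitive.of_ne_one hθ),
    ← mul_gaussSum_inv_eq_gaussSum χ⁻¹ θ, MulChar.inv_apply', inv_neg_one]
  ring

variable [DecidableEq F]

variable (F) in
/-- The quadratic character of `F` with values in `ℂ`. -/
noncomputable def quadraticCharC : MulChar F ℂ :=
  (quadraticChar F).ringHomComp (Int.castRingHom ℂ)

theorem quadraticCharC_apply (x : F) : quadraticCharC F x = (quadraticChar F x : ℂ) := rfl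

theorem quadraticCharC_sq : quadraticCharC F ^ 2 = 1 :=
  ((quadraticChar_isQuadratic F).comp _).sq_eq_one

theorem quadraticCharC_inv : (quadraticCharC F)⁻¹ = quadraticCharC F :=
  ((quadraticChar_isQuadratic F).comp _).inv

theorem quadraticCharC_ne_one (hF : ringChar F ≠ 2) : quadraticCharC F ≠ 1 :=
  (MulChar.ringHomComp_ne_one_iff (RingHom.injective_int _)).2 (quadraticChar_ne_one hF)

theorem quadraticCharC_apply_sq {x : F} (hx : x ≠ 0) : quadraticCharC F (x ^ 2) = 1 := by
  rw [quadraticCharC_apply, quadraticChar_sq_one' hx, Int.cast_one]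

theorem card_sqrts (hF : ringChar F ≠ 2) (v : F) :
    (#{x : F | x ^ 2 = v} : ℂ) = 1 + quadraticCharC F v := by
  have h := congrArg (Int.cast : ℤ → ℂ) (quadraticChar_card_sqrts hF v)
  push_cast at h
  rw [quadraticCharC_apply, add_comm, ← h]
  congr 2
  ext x
  simp

theorem eq_quadraticCharC {χ : MulChar F ℂ} (h : χ ^ 2 = 1) (h1 : χ ≠ 1) :
    χ = quadraticCharC F := by
  have hsq {x : F} (hx : x ≠ 0) : χ x ^ 2 = 1 := by
    rw [← MulChar.pow_apply' χ two_ne_zero, h, MulChar.one_apply hx.isUnit]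
  have hone {x : F} (hx : x ≠ 0) (hs : IsSquare x) : χ x = 1 := by
    obtain ⟨y, rfl⟩ := hs
    rw [← pow_two, map_pow, hsq (by rintro rfl; simp at hx)]
  obtain ⟨v, hv⟩ := MulChar.ne_one_iff.1 h1
  have hvs : ¬ IsSquare (v : F) := fun hs => hv (hone v.ne_zero hs)
  have hv1 : χ v = -1 :=
    (sq_eq_sq_iff_eq_or_eq_neg.1 ((hsq v.ne_zero).trans (one_pow 2).symm)).resolve_left hv
  ext x
  rw [quadraticCharC_apply]
  by_cases hx : IsSquare (x : F)
  · rw [hone x.ne_zero hx, (quadraticChar_one_iff_isSquare x.ne_zero).2 hx, Int.cast_one]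
  · rw [quadraticChar_neg_one_iff_not_isSquare.2 hx, Int.cast_neg, Int.cast_one]
    have hxv : IsSquare ((x : F) * v) := by
      rw [← quadraticChar_one_iff_isSquare (mul_ne_zero x.ne_zero v.ne_zero), map_mul,
        quadraticChar_neg_one_iff_not_isSquare.2 hx, quadraticChar_neg_one_iff_not_isSquare.2 hvs]
      norm_num
    have := hone (mul_ne_zero x.ne_zero v.ne_zero) hxv
    rw [map_mul, hv1] at this
    linear_combination -this

theorem jacobiSum_self (hF : ringChar F ≠ 2) {A : MulChar F ℂ} (hA : A ≠ 1) :
    jacobiSum A A = A⁻¹ 4 * jacobiSum A (quadraticCharC F) := by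
  have h2 : (2 : F) ≠ 0 := Ring.two_ne_zero hF
  have h4 : (4 : F) ≠ 0 := by
    have : (4 : F) = 2 ^ 2 := by norm_num
    rw [this]; exact pow_ne_zero _ h2
  calc jacobiSum A A = ∑ x : F, A⁻¹ 4 * A (1 - (2 * x - 1) ^ 2) := by
        refine sum_congr rfl fun x _ => ?_
        rw [show 1 - (2 * x - 1) ^ 2 = 4 * (x * (1 - x)) by ring, map_mul A 4, map_mul,
          ← mul_assoc, MulChar.inv_mul_apply_self A h4, one_mul]
    _ = ∑ z : F, A⁻¹ 4 * A (1 - z ^ 2) :=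
        ((Equiv.mulLeft₀ 2 h2).trans (Equiv.subRight 1)).sum_comp
          fun z : F => A⁻¹ 4 * A (1 - z ^ 2)
    _ = A⁻¹ 4 * ∑ v : F, (1 + quadraticCharC F v) * A (1 - v) := by
        rw [← mul_sum]
        congr 1
        rw [← sum_fiberwise univ fun z : F => z ^ 2]
        refine sum_congr rfl fun v _ => ?_
        rw [← card_sqrts hF, ← nsmul_eq_mul, ← sum_const]
        refine sum_congr rfl fun z hz => ?_
        rw [(mem_filter.1 hz).2]
    _ = _ := by
        rw [jacobiSum_comm]
        simp_rw [add_mul, one_mul, sum_add_distrib]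
        rw [show ∑ v, A (1 - v) = ∑ v, A v from (Equiv.subLeft 1).sum_comp fun v => A v,
          MulChar.sum_eq_zero_of_ne_one hA, zero_add]
        rfl

/-- The Hasse-Davenport product formula for the quadratic character. -/
theorem gaussSum_mul_gaussSum_quadraticChar (hF : ringChar F ≠ 2) (A : MulChar F ℂ)
    {θ : AddChar F ℂ} (hθ : θ ≠ 1) :
    gaussSum A θ * gaussSum (A * quadraticCharC F) θ =
      A⁻¹ 4 * gaussSum (A ^ 2) θ * gaussSum (quadraticCharC F) θ := by
  have h2 : (2 : F) ≠ 0 := Ring.two_ne_zero hF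
  have h4 : (4 : F) = 2 ^ 2 := by norm_num
  by_cases hA : A = 1
  · subst hA
    rw [one_mul, one_pow, inv_one, MulChar.one_apply (by rw [h4]; exact (pow_ne_zero _ h2).isUnit),
      one_mul]
  by_cases hA2 : A ^ 2 = 1
  · rw [eq_quadraticCharC hA2 hA, ← pow_two, quadraticCharC_inv, h4, quadraticCharC_apply_sq h2]
    ring
  have hAφ : A * quadraticCharC F ≠ 1 := by
    intro h
    apply hA2
    rw [eq_inv_of_mul_eq_one_left h, quadraticCharC_inv, quadraticCharC_sq]
  have e1 := jacobiSum_mul_nontrivial (pow_two A ▸ hA2) θ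
  have e2 := jacobiSum_mul_nontrivial hAφ θ
  rw [← pow_two, jacobiSum_self hF hA] at e1
  have hg : gaussSum A θ ≠ 0 := gaussSum_ne_zero_of_nontrivial
    (Nat.cast_ne_zero.2 Fintype.card_ne_zero) hA (AddChar.IsPrimitive.of_ne_one hθ)
  apply mul_left_cancel₀ hg
  linear_combination A⁻¹ 4 * gaussSum (A ^ 2) θ * e2 - gaussSum (A * quadraticCharC F) θ * e1

end GaussSum

section Mellin

variable {F : Type} [Field F] [Fintype F]

/-- Mellin transform of an Euler-type integral for `₂F₁`. -/
theorem sum_mul_sum_euler {η : MulChar F ℂ} (hη : η ≠ 1) (κ β : MulChar F ℂ)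
    (θ : AddChar F ℂ) :
    (∑ w : F, β w * ∑ V : F, η (1 - V) * κ V * η⁻¹ (1 - w * V)) *
        (gaussSum η θ * gaussSum η⁻¹ θ) =
      κ (-1) * gaussSum β θ * gaussSum (η * β⁻¹) θ * gaussSum (κ * β⁻¹) θ *
        gaussSum (η⁻¹ * κ⁻¹ * β) θ := by
  have h1 (v : F) : η⁻¹ v * gaussSum η θ = ∑ y, η y * θ (v * y) :=
    (sum_mulChar_mul_addChar_of_ne_one hη θ v).symm
  have h2 (v : F) : η v * gaussSum η⁻¹ θ = ∑ z, η⁻¹ z * θ (v * z) := by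
    rw [sum_mulChar_mul_addChar_of_ne_one (inv_ne_one.2 hη), inv_inv]
  have hneg (χ : MulChar F ℂ) : χ (-1) * χ⁻¹ (-1) = 1 := by
    rw [mul_comm, MulChar.inv_mul_apply_self χ (neg_ne_zero.2 one_ne_zero)]
  have hneg2 (χ : MulChar F ℂ) : χ⁻¹ (-1) = χ (-1) := by
    rw [MulChar.inv_apply', inv_neg_one]
  have hw (V : F) : (∑ w : F, β w * η⁻¹ (1 - w * V)) * gaussSum η θ * κ V =
      β (-1) * gaussSum β θ * gaussSum (η * β⁻¹) θ * (κ * β⁻¹) V := by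
    rcases eq_or_ne V 0 with rfl | hV
    · simp [MulChar.map_zero]
    · calc (∑ w : F, β w * η⁻¹ (1 - w * V)) * gaussSum η θ * κ V
          = (∑ y : F, η y * θ y * ∑ w : F, β w * θ (-(V * y) * w)) * κ V := by
            congr 1
            simp_rw [sum_mul, mul_assoc, h1, mul_sum]
            rw [sum_comm]
            refine sum_congr rfl fun y _ => sum_congr rfl fun w _ => ?_
            rw [show (1 - w * V) * y = y + -(V * y) * w by ring, AddChar.map_add_eq_mul]
            ring
        _ = (∑ y : F, (η * β⁻¹) y * θ y * (β (-1) * β⁻¹ V * gaussSum β θ)) * κ V := by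
            congr 1
            refine sum_congr rfl fun y _ => ?_
            rcases eq_or_ne y 0 with rfl | hy
            · simp [MulChar.map_zero]
            · rw [sum_mulChar_mul_addChar β θ (neg_ne_zero.2 (mul_ne_zero hV hy)),
                ← neg_one_mul, map_mul, map_mul, MulChar.mul_apply, hneg2]
              ring
        _ = _ := by
            rw [← sum_mul, ← gaussSum, MulChar.mul_apply κ]
            ring
  have hV : (∑ V : F, η (1 - V) * (κ * β⁻¹) V) * gaussSum η⁻¹ θ =
      κ (-1) * β (-1) * gaussSum (κ * β⁻¹) θ * gaussSum (η⁻¹ * κ⁻¹ * β) θ := by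
    calc (∑ V : F, η (1 - V) * (κ * β⁻¹) V) * gaussSum η⁻¹ θ
        = ∑ z : F, η⁻¹ z * θ z * ∑ V : F, (κ * β⁻¹) V * θ (-z * V) := by
          simp_rw [sum_mul, mul_right_comm _ _ (gaussSum _ _), h2, sum_mul, mul_sum]
          rw [sum_comm]
          refine sum_congr rfl fun y _ => sum_congr rfl fun w _ => ?_
          rw [show (1 - w) * y = y + -y * w by ring, AddChar.map_add_eq_mul]
          ring
      _ = ∑ z : F, (η⁻¹ * κ⁻¹ * β) z * θ z * (κ (-1) * β (-1) * gaussSum (κ * β⁻¹) θ) := by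
          refine sum_congr rfl fun z _ => ?_
          rcases eq_or_ne z 0 with rfl | hz
          · simp [MulChar.map_zero]
          · rw [sum_mulChar_mul_addChar _ θ (neg_ne_zero.2 hz), mul_inv, inv_inv,
              ← neg_one_mul, map_mul]
            simp only [MulChar.mul_apply, hneg2]
            ring
      _ = _ := by
          rw [← sum_mul, ← gaussSum]
          ring
  calc (∑ w : F, β w * ∑ V : F, η (1 - V) * κ V * η⁻¹ (1 - w * V)) *
        (gaussSum η θ * gaussSum η⁻¹ θ)
      = (∑ V : F, η (1 - V) * ((∑ w : F, β w * η⁻¹ (1 - w * V)) * gaussSum η θ * κ V)) *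
          gaussSum η⁻¹ θ := by
        rw [← mul_assoc]
        congr 1
        simp_rw [sum_mul, mul_sum, sum_mul]
        rw [sum_comm]
        refine sum_congr rfl fun y _ => sum_congr rfl fun w _ => ?_
        ring
    _ = β (-1) * gaussSum β θ * gaussSum (η * β⁻¹) θ *
          ((∑ V : F, η (1 - V) * (κ * β⁻¹) V) * gaussSum η⁻¹ θ) := by
        simp_rw [hw, sum_mul, mul_sum]
        refine sum_congr rfl fun V _ => ?_
        ring
    _ = _ := by
        have := hneg β
        rw [hneg2] at this
        rw [hV]
        linear_combination (κ (-1) * gaussSum β θ * gaussSum (η * β⁻¹) θ *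
          gaussSum (κ * β⁻¹) θ * gaussSum (η⁻¹ * κ⁻¹ * β) θ) * this

variable [DecidableEq F]

theorem sum_mul_sum_addChar_cubic (h2 : (2 : F) ≠ 0) (h3 : (3 : F) ≠ 0) {d : F}
    (hd : d ^ 2 = -3) {ω : MulChar F ℂ} (hω : ω ^ 3 = 1) (hω1 : ω ≠ 1) (α : MulChar F ℂ)
    {θ : AddChar F ℂ} (hθ : θ ≠ 1) :
    ∑ N : F, α N * ∑ x : F, θ (x + N * x ^ 3) =
      α⁻¹ (-27) * (gaussSum (α⁻¹ * ω) θ * gaussSum (α⁻¹ * ω⁻¹) θ) := by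
  have h27 : (-27 : F) ≠ 0 := by
    have : (-27 : F) = (-3) ^ 3 := by norm_num
    rw [this]; exact pow_ne_zero _ (neg_ne_zero.2 h3)
  calc ∑ N : F, α N * ∑ x : F, θ (x + N * x ^ 3)
      = ∑ P : F, α (-27 * P)⁻¹ * ∑ x : F, θ (x + (-27 * P)⁻¹ * x ^ 3) :=
        (((Equiv.mulLeft₀ (-27) h27).trans (Equiv.inv F)).sum_comp
          fun N : F => α N * ∑ x : F, θ (x + N * x ^ 3)).symm
    _ = ∑ P : F, α⁻¹ (-27) * ∑ u : F, α⁻¹ P * ω (u ^ 2 / P) * θ (u + P / u) := by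
        refine sum_congr rfl fun P _ => ?_
        rw [← MulChar.inv_apply', map_mul]
        rcases eq_or_ne P 0 with rfl | hP
        · simp [MulChar.map_zero]
        · simp_rw [mul_assoc, ← mul_sum]
          rw [← sum_addChar_cubic h2 h3 hd hω hω1 hP hθ]
          congr 2
          refine sum_congr rfl fun x _ => ?_
          rw [neg_mul, inv_neg, neg_mul, ← sub_eq_add_neg, inv_mul_eq_div]
    _ = α⁻¹ (-27) * ∑ u : F, ∑ v : F, α⁻¹ u * ω u * θ u * (α⁻¹ v * ω⁻¹ v * θ v) := by
        rw [← mul_sum, sum_comm]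
        congr 1
        refine sum_congr rfl fun u _ => ?_
        rcases eq_or_ne u 0 with rfl | hu
        · simp [MulChar.map_zero]
        · rw [← Equiv.sum_comp (Equiv.mulLeft₀ u hu)]
          refine sum_congr rfl fun v _ => ?_
          simp only [Equiv.mulLeft₀_apply]
          rcases eq_or_ne v 0 with rfl | hv
          · simp [MulChar.map_zero]
          · rw [show u ^ 2 / (u * v) = u * v⁻¹ by field_simp, mul_div_cancel_left₀ _ hu,
              AddChar.map_add_eq_mul, map_mul, map_mul, MulChar.inv_apply' ω]
            ring
    _ = _ := by
        simp_rw [gaussSum, sum_mul_sum, MulChar.mul_apply]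

/-- Mellin transform of `t ↦ ∑ x, φ (1 + x + t * x ^ 3)`. -/
theorem sum_mul_sum_quadraticChar_cubic (hF : ringChar F ≠ 2) (h3 : (3 : F) ≠ 0) {d : F}
    (hd : d ^ 2 = -3) {ω : MulChar F ℂ} (hω : ω ^ 3 = 1) (hω1 : ω ≠ 1) (α : MulChar F ℂ)
    {θ : AddChar F ℂ} (hθ : θ ≠ 1) :
    (∑ t : F, α t * ∑ x : F, quadraticCharC F (1 + x + t * x ^ 3)) *
        gaussSum (quadraticCharC F) θ =
      α⁻¹ (-27) * gaussSum (α ^ 2 * quadraticCharC F) θ *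
        (gaussSum (α⁻¹ * ω) θ * gaussSum (α⁻¹ * ω⁻¹) θ) := by
  have hφ (v : F) : quadraticCharC F v * gaussSum (quadraticCharC F) θ =
      ∑ y, quadraticCharC F y * θ (v * y) := by
    rw [sum_mulChar_mul_addChar_of_ne_one (quadraticCharC_ne_one hF), quadraticCharC_inv]
  calc (∑ t : F, α t * ∑ x : F, quadraticCharC F (1 + x + t * x ^ 3)) *
        gaussSum (quadraticCharC F) θ
      = ∑ t : F, ∑ x : F, ∑ y : F, quadraticCharC F y * θ y *
          (α t * θ (y * x + t * y * x ^ 3)) := by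
        simp_rw [sum_mul, mul_assoc (α _), sum_mul, hφ, mul_sum]
        refine sum_congr rfl fun t _ => sum_congr rfl fun x _ => sum_congr rfl fun y _ => ?_
        rw [show (1 + x + t * x ^ 3) * y = y + (y * x + t * y * x ^ 3) by ring,
          AddChar.map_add_eq_mul]
        ring
    _ = ∑ y : F, quadraticCharC F y * θ y *
          ∑ t : F, α t * ∑ x : F, θ (y * x + t * y * x ^ 3) := by
        simp_rw [mul_sum]
        rw [sum_congr rfl fun t _ => sum_comm, sum_comm]
    _ = ∑ y : F, quadraticCharC F y * θ y *
          (α y ^ 2 * ∑ N : F, α N * ∑ x : F, θ (x + N * x ^ 3)) := by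
        refine sum_congr rfl fun y _ => ?_
        rcases eq_or_ne y 0 with rfl | hy
        · simp [MulChar.map_zero]
        · congr 1
          rw [← Equiv.sum_comp (Equiv.mulLeft₀ (y ^ 2) (pow_ne_zero 2 hy)), mul_sum]
          refine sum_congr rfl fun N _ => ?_
          rw [← Equiv.sum_comp (Equiv.mulLeft₀ y⁻¹ (inv_ne_zero hy)), Equiv.mulLeft₀_apply, map_mul,
            map_pow, mul_assoc]
          congr 2
          refine sum_congr rfl fun x _ => ?_
          rw [Equiv.mulLeft₀_apply]
          congr 1
          field_simp
    _ = _ := by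
        have hg : gaussSum (α ^ 2 * quadraticCharC F) θ =
            ∑ y : F, quadraticCharC F y * θ y * α y ^ 2 := by
          refine sum_congr rfl fun y _ => ?_
          rw [MulChar.mul_apply, MulChar.pow_apply' α two_ne_zero]
          ring
        simp_rw [← mul_assoc, ← sum_mul]
        rw [← hg, sum_mul_sum_addChar_cubic (Ring.two_ne_zero hF) h3 hd hω hω1 α hθ]
        ring

end Mellin

section Generator

variable {F : Type} [Field F] [Fintype F] {T : MulChar F ℂ}

theorem MulChar.generator_pow_card (T : MulChar F ℂ) : T ^ (Fintype.card F - 1) = 1 := by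
  classical
  rw [← Fintype.card_units]
  exact T.pow_card_eq_one

theorem sum_generator_pow_apply (hT : ∀ χ : MulChar F ℂ, ∃ n : ℕ, χ = T ^ n) (v : F)
    [Decidable (v = 1)] :
    ∑ m ∈ range (Fintype.card F - 1), (T ^ m) v =
      if v = 1 then (Fintype.card F : ℂ) - 1 else 0 := by
  split_ifs with h
  · subst h
    simp_rw [map_one]
    rw [sum_const, card_range, nsmul_eq_mul, mul_one, Nat.cast_sub Fintype.card_pos, Nat.cast_one]
  · rcases eq_or_ne v 0 with rfl | hv
    · exact sum_eq_zero fun m _ => MulChar.map_zero _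
    · have hpow (m : ℕ) : (T ^ m) v = T v ^ m := MulChar.pow_apply_coe T m (Units.mk0 v hv)
      have hTv : T v ≠ 1 := by
        intro hTv
        obtain ⟨χ, hχ⟩ := MulChar.exists_apply_ne_one_of_hasEnoughRootsOfUnity F ℂ h
        obtain ⟨n, rfl⟩ := hT χ
        exact hχ (by rw [hpow, hTv, one_pow])
      simp_rw [hpow]
      apply mul_left_cancel₀ (sub_ne_zero.2 hTv)
      rw [mul_geom_sum, ← hpow, MulChar.generator_pow_card, MulChar.one_apply hv.isUnit, sub_self,
        mul_zero]

/-- Mellin inversion: a function on `Fˣ` is determined by its Mellin transform. -/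
theorem eq_of_mellin_eq (hT : ∀ χ : MulChar F ℂ, ∃ n : ℕ, χ = T ^ n) {f g : F → ℂ}
    (h : ∀ χ : MulChar F ℂ, ∑ t, χ t * f t = ∑ t, χ t * g t) {s : F} (hs : s ≠ 0) :
    f s = g s := by
  classical
  have hq : (Fintype.card F : ℂ) - 1 ≠ 0 := by
    rw [sub_ne_zero]
    exact_mod_cast Fintype.one_lt_card.ne'
  have key (f : F → ℂ) : ∑ m ∈ range (Fintype.card F - 1), (T ^ m) s⁻¹ * ∑ t, (T ^ m) t * f t =
      ((Fintype.card F : ℂ) - 1) * f s := by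
    simp_rw [mul_sum, ← mul_assoc, ← map_mul]
    rw [sum_comm]
    simp_rw [← sum_mul, sum_generator_pow_apply hT, inv_mul_eq_one₀ hs, ite_mul, zero_mul]
    simp
  apply mul_left_cancel₀ hq
  rw [← key, ← key]
  simp_rw [h]

/-- Euler-type integral representation of `₂F₁`. -/
theorem card_mul_hypF21 (hT : ∀ χ : MulChar F ℂ, ∃ n : ℕ, χ = T ^ n) (A B C : MulChar F ℂ)
    {z : F} (hz : z ≠ 0) :
    (Fintype.card F : ℂ) * hypF21 F T A B C z =
      C (-1) * ∑ V : F, B (1 - V) * (A * C⁻¹) V * A⁻¹ (V + (1 - V) * z) := by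
  classical
  have hq : (Fintype.card F : ℂ) - 1 ≠ 0 := by
    rw [sub_ne_zero]
    exact_mod_cast Fintype.one_lt_card.ne'
  have hq0 : (Fintype.card F : ℂ) ≠ 0 := Nat.cast_ne_zero.2 Fintype.card_ne_zero
  have hterm (m : ℕ) : binomC F (A * T ^ m) (T ^ m) * binomC F (B * T ^ m) (C * T ^ m) *
      (T ^ m) z = C (-1) / (Fintype.card F : ℂ) ^ 2 * ∑ y : F, ∑ x : F,
        A x * B y * C⁻¹ (1 - y) * (T ^ m) (x * y * z * (1 - x)⁻¹ * (1 - y)⁻¹) := by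
    have hneg : (T ^ m) (-1) * (T ^ m) (-1) = 1 := by
      rw [← map_mul, neg_one_mul, neg_neg, map_one]
    have hJ : jacobiSum (A * T ^ m) (T ^ m)⁻¹ * jacobiSum (B * T ^ m) (C * T ^ m)⁻¹ * (T ^ m) z =
        ∑ y : F, ∑ x : F,
          A x * B y * C⁻¹ (1 - y) * (T ^ m) (x * y * z * (1 - x)⁻¹ * (1 - y)⁻¹) := by
      rw [jacobiSum, jacobiSum, sum_mul_sum, sum_comm]
      simp_rw [sum_mul]
      refine sum_congr rfl fun y _ => sum_congr rfl fun x _ => ?_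
      simp only [mul_inv, MulChar.mul_apply, map_mul, MulChar.inv_apply']
      ring
    rw [← hJ, binomC, binomC, MulChar.mul_apply C]
    field_simp
    linear_combination (C (-1) * jacobiSum (A * T ^ m) (T ^ m)⁻¹ *
      jacobiSum (B * T ^ m) (C * T ^ m)⁻¹ * (T ^ m) z) * hneg
  have hinner (y : F) : ∑ x : F, A x * B y * C⁻¹ (1 - y) *
      (if x * y * z * (1 - x)⁻¹ * (1 - y)⁻¹ = 1 then (Fintype.card F : ℂ) - 1 else 0) =
      ((Fintype.card F : ℂ) - 1) * (B y * (A * C⁻¹) (1 - y) * A⁻¹ (1 - y + y * z)) := by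
    by_cases hy : y = 0
    · subst hy; simp [MulChar.map_zero]
    by_cases hy1 : 1 - y = 0
    · rw [hy1]; simp [MulChar.map_zero]
    have hiff (x : F) : x * y * z * (1 - x)⁻¹ * (1 - y)⁻¹ = 1 ↔
        x * (1 - y + y * z) = 1 - y := by
      by_cases hx : 1 - x = 0
      · have : x = 1 := (sub_eq_zero.1 hx).symm
        subst this
        simp [hy, hz]
      · field_simp
        constructor <;> intro h <;> linear_combination h
    simp_rw [hiff]
    by_cases hD : 1 - y + y * z = 0
    · have : ¬ (0 = 1 - y) := fun h => hy1 h.symm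
      simp [hD, this, MulChar.map_zero]
    · simp_rw [← eq_div_iff hD, mul_ite, mul_zero]
      rw [sum_ite_eq' univ, if_pos (mem_univ _), div_eq_mul_inv, map_mul, MulChar.mul_apply,
        MulChar.inv_apply' A]
      ring
  have hsum : ∑ m ∈ range (Fintype.card F - 1), binomC F (A * T ^ m) (T ^ m) *
      binomC F (B * T ^ m) (C * T ^ m) * (T ^ m) z = C (-1) / (Fintype.card F : ℂ) ^ 2 *
        (((Fintype.card F : ℂ) - 1) *
          ∑ y : F, B y * (A * C⁻¹) (1 - y) * A⁻¹ (1 - y + y * z)) := by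
    simp_rw [hterm, ← mul_sum]
    congr 1
    rw [sum_comm, mul_sum]
    refine sum_congr rfl fun y _ => ?_
    rw [sum_comm, ← hinner]
    simp_rw [← mul_sum, sum_generator_pow_apply hT]
  rw [hypF21, hsum, ← Equiv.sum_comp (Equiv.subLeft (1 : F))]
  simp only [Equiv.subLeft_apply, sub_sub_cancel]
  generalize ∑ V : F, B (1 - V) * (A * C⁻¹) V * A⁻¹ (V + (1 - V) * z) = S
  field_simp

end Generator

section CubicEuler

variable {F : Type} [Field F] [Fintype F] {η : MulChar F ℂ}

theorem sum_mulChar_mul_comp_mul (R : F → ℂ) (β : MulChar F ℂ) {c : F} (hc : c ≠ 0) :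
    ∑ t, β t * R (c * t) = β⁻¹ c * ∑ w, β w * R w := by
  rw [← Equiv.sum_comp (Equiv.mulLeft₀ c hc) fun w => β w * R w, mul_sum]
  refine sum_congr rfl fun t _ => ?_
  rw [Equiv.mulLeft₀_apply, map_mul, ← mul_assoc, ← mul_assoc, MulChar.inv_mul_apply_self β hc,
    one_mul]

variable [DecidableEq F]

theorem quadraticCharC_eq_pow_six (h12 : η ^ 12 = 1) (h6 : η ^ 6 ≠ 1) :
    quadraticCharC F = η ^ 6 :=
  (eq_quadraticCharC (by rw [← pow_mul, h12]) h6).symm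

theorem sum_mul_sum_quadraticChar_cubic_eq_euler (hF : ringChar F ≠ 2) (h3 : (3 : F) ≠ 0) {d : F}
    (hd : d ^ 2 = -3) (h12 : η ^ 12 = 1) (h4 : η ^ 4 ≠ 1) (h6 : η ^ 6 ≠ 1) (β : MulChar F ℂ) :
    ∑ t : F, (β * η ^ 3) t * ∑ x : F, quadraticCharC F (1 + x + t * x ^ 3) =
      (β * η ^ 3)⁻¹ (-27) * β 4 *
        ∑ w : F, β w * ∑ V : F, η (1 - V) * (η ^ 5) V * η⁻¹ (1 - w * V) := by
  have hq0 : (Fintype.card F : ℂ) ≠ 0 := Nat.cast_ne_zero.2 Fintype.card_ne_zero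
  obtain ⟨θ, hθ1⟩ := AddChar.exists_apply_ne_zero.2 (one_ne_zero (α := F))
  have hθ : θ ≠ 1 := by
    rintro rfl
    exact hθ1 (AddChar.one_apply _)
  have h1 : η ≠ 1 := by
    rintro rfl
    exact h4 (one_pow _)
  have hφ := quadraticCharC_eq_pow_six h12 h6
  have hneg : η (-1) ^ 2 = 1 := by rw [← map_pow, neg_one_sq, map_one]
  have hη : gaussSum η θ * gaussSum η⁻¹ θ = η (-1) * Fintype.card F :=
    gaussSum_mul_gaussSum_inv h1 hθ
  have hφφ : gaussSum (quadraticCharC F) θ * gaussSum (quadraticCharC F) θ = Fintype.card F := by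
    have := gaussSum_mul_gaussSum_inv (quadraticCharC_ne_one hF) hθ
    rw [quadraticCharC_inv] at this
    rw [this, hφ, MulChar.pow_apply' η (by norm_num), show η (-1) ^ 6 = (η (-1) ^ 2) ^ 3 by ring,
      hneg, one_pow, one_mul]
  have hω : (η ^ 4)⁻¹ = η ^ 8 := by
    rw [inv_eq_iff_mul_eq_one, ← pow_add, h12]
  have hη6 : η⁻¹ * (η ^ 5)⁻¹ = η ^ 6 := by
    rw [← mul_inv, inv_eq_iff_mul_eq_one, ← pow_succ', ← pow_add, h12]
  have hβ : (β * η ^ 3) ^ 2 * quadraticCharC F = β ^ 2 := by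
    rw [hφ, mul_pow, ← pow_mul, mul_assoc, ← pow_add, h12, mul_one]
  have e1 : (β * η ^ 3)⁻¹ * η ^ 4 = η * β⁻¹ := by
    rw [inv_mul_eq_iff_eq_mul]
    simp [mul_comm, mul_left_comm, pow_succ, mul_assoc]
  have e2 : (β * η ^ 3)⁻¹ * η ^ 8 = η ^ 5 * β⁻¹ := by
    rw [inv_mul_eq_iff_eq_mul]
    simp [mul_comm, mul_left_comm, pow_succ, mul_assoc]
  have hL := sum_mul_sum_quadraticChar_cubic hF h3 hd (ω := η ^ 4) (by rw [← pow_mul, h12]) h4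
    (β * η ^ 3) hθ
  rw [hβ, hω, e1, e2] at hL
  have hR := sum_mul_sum_euler h1 (η ^ 5) β θ
  rw [hη6, mul_comm (η ^ 6), ← hφ, hη, MulChar.pow_apply' η (by norm_num)] at hR
  have hD := gaussSum_mul_gaussSum_quadraticChar hF β hθ
  have h4' : β⁻¹ 4 * β 4 = 1 := by
    refine MulChar.inv_mul_apply_self β ?_
    rw [show (4 : F) = 2 * 2 by norm_num]
    exact mul_ne_zero (Ring.two_ne_zero hF) (Ring.two_ne_zero hF)
  generalize ∑ t : F, (β * η ^ 3) t * ∑ x : F, quadraticCharC F (1 + x + t * x ^ 3) = L at *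
  generalize ∑ w : F, β w * ∑ V : F, η (1 - V) * (η ^ 5) V * η⁻¹ (1 - w * V) = R at *
  generalize gaussSum (quadraticCharC F) θ = gφ at *
  generalize gaussSum (β * quadraticCharC F) θ = gβφ at *
  generalize gaussSum β θ = gβ at *
  generalize gaussSum (η * β⁻¹) θ = g1 at *
  generalize gaussSum (η ^ 5 * β⁻¹) θ = g5 at *
  generalize gaussSum (β ^ 2) θ = gβ2 at *
  generalize (β * η ^ 3)⁻¹ (-27) = α at *
  generalize (Fintype.card F : ℂ) = q at *
  generalize η (-1) = s at *
  generalize β⁻¹ 4 = u at *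
  generalize β 4 = v at *
  have hR' : R * q = u * gβ2 * gφ * g1 * g5 := by
    have : R * q = gβ * g1 * g5 * gβφ := by
      linear_combination s * hR - (R * q - (s ^ 4 + s ^ 2 + 1) * gβ * g1 * g5 * gβφ) * hneg
    rw [this]
    linear_combination g1 * g5 * hD
  apply mul_right_cancel₀ hq0
  linear_combination gφ * hL - L * hφφ - α * v * hR' - α * gβ2 * gφ * g1 * g5 * h4'

theorem mul_sum_quadraticChar_cubic (hF : ringChar F ≠ 2) (h3 : (3 : F) ≠ 0) {d : F}
    (hd : d ^ 2 = -3) (h12 : η ^ 12 = 1) (h4 : η ^ 4 ≠ 1) (h6 : η ^ 6 ≠ 1) {T : MulChar F ℂ}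
    (hT : ∀ χ : MulChar F ℂ, ∃ n : ℕ, χ = T ^ n) {t : F} (ht : t ≠ 0) :
    (η ^ 3) t * ∑ x : F, quadraticCharC F (1 + x + t * x ^ 3) =
      (η ^ 3) (-3) * ∑ V : F, η (1 - V) * (η ^ 5) V * η⁻¹ (1 - -27 / 4 * t * V) := by
  have h2 := Ring.two_ne_zero hF
  have h3' : (-3 : F) ≠ 0 := neg_ne_zero.2 h3
  have h27 : (-27 : F) ≠ 0 := by
    rw [show (-27 : F) = (-3) ^ 3 by norm_num]; exact pow_ne_zero _ h3'
  have h4F : (4 : F) ≠ 0 := by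
    rw [show (4 : F) = 2 * 2 by norm_num]; exact mul_ne_zero h2 h2
  refine eq_of_mellin_eq hT
    (f := fun t => (η ^ 3) t * ∑ x : F, quadraticCharC F (1 + x + t * x ^ 3))
    (g := fun t => (η ^ 3) (-3) * ∑ V : F, η (1 - V) * (η ^ 5) V * η⁻¹ (1 - -27 / 4 * t * V))
    (fun β => ?_) ht
  have hR : ∑ t, β t *
      ((η ^ 3) (-3) * ∑ V : F, η (1 - V) * (η ^ 5) V * η⁻¹ (1 - -27 / 4 * t * V)) =
      (η ^ 3) (-3) * (β⁻¹ (-27 / 4) *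
        ∑ w, β w * ∑ V : F, η (1 - V) * (η ^ 5) V * η⁻¹ (1 - w * V)) := by
    rw [← sum_mulChar_mul_comp_mul
      (fun w => ∑ V : F, η (1 - V) * (η ^ 5) V * η⁻¹ (1 - w * V)) β (div_ne_zero h27 h4F), mul_sum]
    exact sum_congr rfl fun t _ => mul_left_comm _ _ _
  have hψ : (η ^ 3) (-27)⁻¹ = (η ^ 3) (-3) := by
    have h := MulChar.pow_apply_eq_one (χ := η ^ 3) (n := 4) (by rw [← pow_mul, h12]) (by norm_num)
      h3'
    rw [← mul_one ((η ^ 3) (-27)⁻¹), ← h, ← map_mul]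
    congr 1
    rw [inv_mul_eq_iff_eq_mul₀ h27]
    norm_num
  rw [hR, ← mul_assoc, mul_comm ((η ^ 3) (-3)), div_eq_mul_inv, map_mul,
    MulChar.inv_apply' β 4⁻¹, inv_inv, ← hψ, ← MulChar.inv_apply', mul_right_comm (β⁻¹ _),
    ← MulChar.mul_apply, ← mul_inv,
    ← sum_mul_sum_quadraticChar_cubic_eq_euler hF h3 hd h12 h4 h6]
  exact sum_congr rfl fun t _ => by rw [MulChar.mul_apply, mul_assoc]

end CubicEuler

section Curve

variable {F : Type} [Field F] [Fintype F]

theorem natCard_affine_points [DecidableEq F] (hF : ringChar F ≠ 2) (f : F → F) :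
    (Nat.card {xy : F × F // xy.2 ^ 2 = f xy.1} : ℂ) =
      Fintype.card F + ∑ x, quadraticCharC F (f x) := by
  rw [Nat.card_eq_fintype_card, Fintype.card_subtype, card_filter, Fintype.sum_prod_type]
  push_cast
  have hfiber (x : F) : ∑ y : F, (if y ^ 2 = f x then (1 : ℂ) else 0) =
      1 + quadraticCharC F (f x) := by
    rw [← card_sqrts hF, card_filter]
    push_cast
    rfl
  simp_rw [hfiber, sum_add_distrib]
  simp

theorem sum_quadraticChar_weierstrass [DecidableEq F] {a b : F} (ha : a ≠ 0) (hb : b ≠ 0) :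
    ∑ x : F, quadraticCharC F (x ^ 3 + a * x + b) =
      quadraticCharC F b * ∑ x : F, quadraticCharC F (1 + x + b ^ 2 / a ^ 3 * x ^ 3) := by
  rw [← Equiv.sum_comp (Equiv.mulLeft₀ (b / a) (div_ne_zero hb ha)), mul_sum]
  refine sum_congr rfl fun x _ => ?_
  rw [Equiv.mulLeft₀_apply, ← map_mul]
  congr 1
  field_simp
  ring

theorem exists_sq_eq_neg_three (h : 3 ∣ Fintype.card F - 1) : ∃ d : F, d ^ 2 = -3 := by
  classical
  have : Fact (Nat.Prime 3) := ⟨Nat.prime_three⟩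
  obtain ⟨u, hu⟩ := exists_prime_orderOf_dvd_card (G := Fˣ) 3 (by rwa [Fintype.card_units])
  have hu3 : (u : F) ^ 3 = 1 := by
    rw [← Units.val_pow_eq_pow_val, ← hu, pow_orderOf_eq_one, Units.val_one]
  have hu1 : (u : F) - 1 ≠ 0 := by
    rw [sub_ne_zero]
    intro h1
    rw [Units.val_eq_one.1 h1, orderOf_one] at hu
    norm_num at hu
  refine ⟨2 * u + 1, ?_⟩
  apply mul_left_cancel₀ hu1
  linear_combination 4 * hu3

theorem MulChar.generator_pow_ne_one {T : MulChar F ℂ}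
    (hT : ∀ χ : MulChar F ℂ, ∃ n : ℕ, χ = T ^ n) {k : ℕ} (hk : k ≠ 0)
    (hkq : k < Fintype.card F - 1) : T ^ k ≠ 1 := by
  classical
  intro h
  have hζ := Complex.isPrimitiveRoot_exp (Fintype.card F - 1) (by omega)
  obtain ⟨χ, hχ⟩ := MulChar.exists_mulChar_orderOf F dvd_rfl hζ
  obtain ⟨n, rfl⟩ := hT χ
  have := orderOf_dvd_of_pow_eq_one (show (T ^ n) ^ k = 1 by rw [pow_right_comm, h, one_pow])
  rw [hχ] at this
  exact absurd (Nat.le_of_dvd (Nat.pos_of_ne_zero hk) this) (by omega)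

end Curve

theorem stmt_13 (p e : ℕ) [Fact p.Prime] (hp : 3 < p) (he : 0 < e)
    (F : Type) [Field F] [Fintype F]
    (hq : Fintype.card F = p ^ e) (h12 : Fintype.card F % 12 = 1)
    (a b : F) (ha : a ≠ 0) (hb : b ≠ 0) (hΔ : 4 * a ^ 3 + 27 * b ^ 2 ≠ 0)
    (T : MulChar F ℂ) (hT : ∀ χ : MulChar F ℂ, ∃ n : ℕ, χ = T ^ n) :
    (Fintype.card F : ℂ) + 1 -
        ((Nat.card {xy : F × F // xy.2 ^ 2 = xy.1 ^ 3 + a * xy.1 + b} + 1 : ℕ) : ℂ) =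
      -(Fintype.card F : ℂ) *
        (T ^ ((Fintype.card F - 1) / 12)) (1728 / (-16 * (4 * a ^ 3 + 27 * b ^ 2))) *
        hypF21 F T (T ^ ((Fintype.card F - 1) / 12)) (T ^ ((Fintype.card F - 1) / 12))
          (T ^ (2 * ((Fintype.card F - 1) / 3)))
          (1728 * (4 * a ^ 3) / (4 * a ^ 3 + 27 * b ^ 2) / 1728) := by
  classical
  have hp' : p.Prime := Fact.out
  have hn : 0 < (Fintype.card F - 1) / 12 := by
    have := Fintype.one_lt_card (α := F)
    omega
  have hcast {m : ℕ} (hm : m.Coprime p) : (m : F) ≠ 0 := by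
    intro h
    have : CharP F p := charP_of_card_eq_prime_pow hq
    have := (CharP.cast_eq_zero_iff F p m).1 h
    exact hp'.one_lt.ne' (Nat.eq_one_of_dvd_coprimes hm this dvd_rfl)
  have h2 : (2 : F) ≠ 0 := by
    exact_mod_cast hcast ((Nat.coprime_primes Nat.prime_two hp').2 (by omega))
  have h3 : (3 : F) ≠ 0 := by
    exact_mod_cast hcast ((Nat.coprime_primes Nat.prime_three hp').2 (by omega))
  have hF : ringChar F ≠ 2 := by
    intro h
    exact h2 (by exact_mod_cast h ▸ ringChar.Nat.cast_ringChar (R := F))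
  obtain ⟨d, hd⟩ := exists_sq_eq_neg_three (F := F) (by omega)
  set η := T ^ ((Fintype.card F - 1) / 12) with hη
  have hη12 : η ^ 12 = 1 := by
    rw [hη, ← pow_mul, Nat.div_mul_cancel (by omega), MulChar.generator_pow_card]
  have hηne {k : ℕ} (hk : k ≠ 0) (hk12 : k < 12) : η ^ k ≠ 1 := by
    rw [hη, ← pow_mul]
    refine MulChar.generator_pow_ne_one hT (by positivity) ?_
    have : (Fintype.card F - 1) / 12 * 12 = Fintype.card F - 1 := by omega
    conv_rhs => rw [← this]
    exact Nat.mul_lt_mul_of_pos_left hk12 hn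
  have hC : T ^ (2 * ((Fintype.card F - 1) / 3)) = η ^ 8 := by
    rw [hη, ← pow_mul]
    congr 1
    omega
  have hC1 : (η ^ 8) (-1) = 1 :=
    MulChar.val_neg_one_eq_one_of_odd_order (n := 3) (by decide)
      (by rw [← pow_mul, show 8 * 3 = 12 * 2 by rfl, pow_mul, hη12, one_pow])
  have hκ : η * (η ^ 8)⁻¹ = η ^ 5 := by
    rw [mul_inv_eq_iff_eq_mul, ← pow_add, show 5 + 8 = 12 + 1 by rfl, pow_succ, hη12, one_mul]
  have h4F : (4 : F) ≠ 0 := by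
    rw [show (4 : F) = 2 * 2 by norm_num]
    exact mul_ne_zero h2 h2
  have h27 : (27 : F) ≠ 0 := by
    rw [show (27 : F) = 3 ^ 3 by norm_num]
    exact pow_ne_zero _ h3
  have h16 : (16 : F) ≠ 0 := by
    rw [show (16 : F) = 4 * 4 by norm_num]
    exact mul_ne_zero h4F h4F
  have h1728 : (1728 : F) ≠ 0 := by
    rw [show (1728 : F) = 16 * 4 * 27 by norm_num]
    exact mul_ne_zero (mul_ne_zero h16 h4F) h27
  set D := 4 * a ^ 3 + 27 * b ^ 2 with hD
  set t := b ^ 2 / a ^ 3 with ht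
  have hz : 1728 * (4 * a ^ 3) / D / 1728 = 4 * a ^ 3 / D := by
    field_simp
  have hz0 : 4 * a ^ 3 / D ≠ 0 := div_ne_zero (mul_ne_zero h4F (pow_ne_zero 3 ha)) hΔ
  have hlin (V : F) : V + (1 - V) * (4 * a ^ 3 / D) = 4 * a ^ 3 / D * (1 - -27 / 4 * t * V) := by
    rw [ht]
    field_simp
    rw [hD]
    ring
  have hF21 := card_mul_hypF21 hT η η (η ^ 8) hz0
  simp_rw [hC1, one_mul, hκ, hlin, map_mul] at hF21
  have hkey := mul_sum_quadraticChar_cubic hF h3 hd hη12 (hηne (by norm_num) (by norm_num))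
    (hηne (by norm_num) (by norm_num)) hT (div_ne_zero (pow_ne_zero 2 hb) (pow_ne_zero 3 ha))
  rw [← ht] at hkey
  have ha12 : η (a ^ 12) = 1 := MulChar.pow_apply_eq_one hη12 (by norm_num) ha
  have hb' : (η ^ 3) a * quadraticCharC F b = (η ^ 3) t := by
    rw [quadraticCharC_eq_pow_six hη12 (hηne (by norm_num) (by norm_num)),
      MulChar.pow_apply' η (by norm_num), MulChar.pow_apply' η (by norm_num),
      MulChar.pow_apply' η (by norm_num), ← map_pow, ← map_pow, ← map_pow, ← map_mul,
      ← mul_one (η (t ^ 3)), ← ha12, ← map_mul]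
    congr 1
    rw [ht]
    field_simp
  have hc : (η ^ 3) a * (η (1728 / (-16 * D)) * η⁻¹ (4 * a ^ 3 / D)) = (η ^ 3) (-3) := by
    rw [MulChar.pow_apply' η (by norm_num), MulChar.pow_apply' η (by norm_num),
      MulChar.inv_apply', ← map_pow, ← map_pow, ← map_mul, ← map_mul]
    congr 1
    field_simp
    norm_num
  have ha3 : (η ^ 3) a ≠ 0 :=
    right_ne_zero_of_mul_eq_one (MulChar.inv_mul_apply_self (η ^ 3) ha)
  have hcard := natCard_affine_points hF fun x : F => x ^ 3 + a * x + b
  rw [sum_quadraticChar_weierstrass ha hb, ← ht] at hcard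
  simp_rw [mul_left_comm _ (η⁻¹ (4 * a ^ 3 / D)), ← mul_sum] at hF21
  push_cast
  rw [hcard, hC, hz]
  apply mul_left_cancel₀ ha3
  generalize ∑ x : F, quadraticCharC F (1 + x + t * x ^ 3) = S at *
  generalize ∑ V : F, η (1 - V) * (η ^ 5) V * η⁻¹ (1 - -27 / 4 * t * V) = R at *
  linear_combination (-S) * hb' - hkey + R * hc + (η ^ 3) a * η (1728 / (-16 * D)) * hF21
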